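/- arXiv:2411.05947 — 2 statements merged into one kernel-verified Lean document; each statement's English description precedes it below -/
import Mathlib

section
/- Let 1 ≤ t ≤ n, let G be a uniformly random matrix in F_2^{n×d}, and let N = N_{Im(G),t} denote the number of vectors w ∈ F_2^n of Hamming weight exactly t satisfying wᵀG = 0. Then for every τ > 0: Pr[ |N - binom(n,t)·2^{-d}| > τ ] ≤ binom(n,t)·(2^{-d} - 2^{-2d}) / τ². -/
open Finset
open scoped Classical

noncomputable section

/-- The character `(-1)^b` of a bit `b ∈ F_2`, valued in `ℝ`. -/
def chi (b : ZMod 2) : ℝ := (-1 : ℝ) ^ b.val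

/-- The `F_2` inner product `⟨v,w⟩ = ∑ i, v i * w i`. -/
def ip {n : ℕ} (v w : Fin n → ZMod 2) : ZMod 2 := ∑ i, v i * w i

/-- Hamming weight of a vector in `F_2^n`. -/
def wt {n : ℕ} (v : Fin n → ZMod 2) : ℕ := (univ.filter fun i => v i ≠ 0).card

/-- `bias(v) = (1/n) ∑ i, (-1)^(v i)`. -/
def bias {n : ℕ} (v : Fin n → ZMod 2) : ℝ := (∑ i, chi (v i)) / n

/-- `bias(S, x) = (1/|S|) ∑_{w ∈ S} (-1)^⟨w,x⟩`. -/
def biasS {n : ℕ} (S : Finset (Fin n → ZMod 2)) (x : Fin n → ZMod 2) : ℝ :=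
  (∑ w ∈ S, chi (ip w x)) / S.card

/-- `S_{t,n}`: the set of Hamming-weight-`t` vectors in `F_2^n`. -/
def sphere (n t : ℕ) : Finset (Fin n → ZMod 2) := univ.filter fun w => wt w = t

/-- Probability of an event under the uniform distribution on a finite type. -/
def probOf {α : Type*} [Fintype α] (P : α → Prop) : ℝ :=
  ((univ.filter P).card : ℝ) / (Fintype.card α : ℝ)

/-- `N_{Im(G),t}`: the number of weight-`t` vectors `w` with `wᵀG = 0`. -/
def numChecks {n d : ℕ} (t : ℕ) (G : Matrix (Fin n) (Fin d) (ZMod 2)) : ℕ :=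
  (univ.filter fun w : Fin n → ZMod 2 => wt w = t ∧ Matrix.vecMul w G = 0).card

lemma Matrix.card_mul_eq_zero {K m n p : Type*} [Field K] [Fintype K] [Fintype m] [Fintype n]
    [Fintype p] (A : Matrix m n K) (hA : LinearIndependent K A.row) :
    Nat.card {G : Matrix n p K // A * G = 0} *
      Nat.card K ^ (Nat.card m * Nat.card p) = Nat.card (Matrix n p K) := by
  have hsurj : Function.Surjective A.mulVec := by
    have h : LinearMap.range A.mulVecLin = ⊤ :=
      Submodule.eq_top_of_finrank_eq (by simpa [Matrix.rank] using hA.rank_matrix)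
    exact LinearMap.range_eq_top.mp h
  obtain ⟨B, hB⟩ := Matrix.mulVec_surjective_iff_exists_right_inverse.mp hsurj
  let f : Matrix n p K →+ Matrix m p K := AddMonoidHom.mk' (A * ·) fun X Y => Matrix.mul_add A X Y
  have hf : Function.Surjective f := fun Y =>
    ⟨B * Y, by simp [f, ← Matrix.mul_assoc, hB]⟩
  have hindex : f.ker.index = Nat.card K ^ (Nat.card m * Nat.card p) := by
    rw [AddSubgroup.index_ker, AddMonoidHom.range_eq_top.mpr hf, AddSubgroup.card_top]
    simp [Matrix, pow_mul, mul_comm (Fintype.card m)]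
  rw [← hindex]
  exact f.ker.card_mul_index

lemma linearIndependent_pair_of_ne {V : Type*} [AddCommGroup V] [Module (ZMod 2) V] {v w : V}
    (hv : v ≠ 0) (hw : w ≠ 0) (hvw : v ≠ w) : LinearIndependent (ZMod 2) ![v, w] := by
  rw [LinearIndependent.pair_iff' hv]
  intro a
  obtain rfl | rfl : a = 0 ∨ a = 1 := by revert a; decide
  · simpa using hw.symm
  · simpa using hvw

/-- Mean of a real-valued random variable under the uniform distribution on a finite type. -/
def mean {α : Type*} [Fintype α] (X : α → ℝ) : ℝ := (∑ a, X a) / Fintype.card α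

lemma probOf_eq_mean {α : Type*} [Fintype α] (P : α → Prop) [DecidablePred P] :
    probOf P = mean fun a => if P a then 1 else 0 := by
  rw [probOf, mean, sum_boole]
  congr!

lemma probOf_abs_gt_le {α : Type*} [Fintype α] (X : α → ℝ) {τ : ℝ} (hτ : 0 < τ) :
    probOf (fun a => τ < |X a|) ≤ mean (fun a => X a ^ 2) / τ ^ 2 := by
  rw [probOf_eq_mean, mean, mean, div_right_comm, sum_div _ fun a => X a ^ 2]
  gcongr with a
  split_ifs with h
  · rw [one_le_div (by positivity), ← sq_abs (X a)]
    gcongr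
  · positivity

lemma mean_sum {α ι : Type*} [Fintype α] (s : Finset ι) (X : ι → α → ℝ) :
    mean (fun a => ∑ i ∈ s, X i a) = ∑ i ∈ s, mean (X i) := by
  simp only [mean]
  rw [sum_comm, sum_div]

/-- A uniformly random `G` satisfies `k` given linearly independent parity checks with
probability `2^{-dk}`. -/
lemma probOf_mul_eq_zero {n d k : ℕ} (A : Matrix (Fin k) (Fin n) (ZMod 2))
    (hA : LinearIndependent (ZMod 2) A.row) :
    probOf (fun G : Matrix (Fin n) (Fin d) (ZMod 2) => A * G = 0) =
      ((2 : ℝ) ^ (-(d : ℤ))) ^ k := by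
  have h := Matrix.card_mul_eq_zero (p := Fin d) A hA
  simp only [Nat.card_eq_fintype_card, Fintype.card_fin, ZMod.card] at h
  rw [probOf, ← Fintype.card_subtype, ← h, zpow_neg, zpow_natCast, inv_pow, ← pow_mul, mul_comm k]
  have : Nonempty {G : Matrix (Fin n) (Fin d) (ZMod 2) // A * G = 0} := ⟨0, Matrix.mul_zero A⟩
  have hcard := Fintype.card_ne_zero (α := {G : Matrix (Fin n) (Fin d) (ZMod 2) // A * G = 0})
  push_cast
  field_simp

lemma probOf_vecMul_eq_zero {n d : ℕ} {w : Fin n → ZMod 2} (hw : w ≠ 0) :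
    probOf (fun G : Matrix (Fin n) (Fin d) (ZMod 2) => Matrix.vecMul w G = 0) =
      (2 : ℝ) ^ (-(d : ℤ)) := by
  have h := probOf_mul_eq_zero (d := d) (Matrix.of ![w])
    (LinearIndependent.of_subsingleton (0 : Fin 1) hw)
  rw [pow_one] at h
  rw [← h]
  congr! 2 with G
  simp [← Matrix.ext_iff, funext_iff]

lemma probOf_vecMul_eq_zero_and {n d : ℕ} {v w : Fin n → ZMod 2} (hv : v ≠ 0) (hw : w ≠ 0)
    (hvw : v ≠ w) :
    probOf (fun G : Matrix (Fin n) (Fin d) (ZMod 2) =>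
      Matrix.vecMul v G = 0 ∧ Matrix.vecMul w G = 0) = ((2 : ℝ) ^ (-(d : ℤ))) ^ 2 := by
  rw [← probOf_mul_eq_zero (d := d) (Matrix.of ![v, w]) (linearIndependent_pair_of_ne hv hw hvw)]
  congr! 2 with G
  simp [← Matrix.ext_iff, funext_iff, Fin.forall_fin_two]

lemma mean_centered_mul {α : Type*} [Fintype α] [Nonempty α] (P Q : α → Prop)
    [DecidablePred P] [DecidablePred Q] {c : ℝ}
    (hP : probOf P = c) (hQ : probOf Q = c) :
    mean (fun a => ((if P a then 1 else 0) - c) * ((if Q a then 1 else 0) - c)) =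
      probOf (fun a => P a ∧ Q a) - c ^ 2 := by
  have hcard : (Fintype.card α : ℝ) ≠ 0 := Nat.cast_ne_zero.mpr Fintype.card_ne_zero
  have hexpand : ∀ a, ((if P a then (1 : ℝ) else 0) - c) * ((if Q a then 1 else 0) - c) =
      (if P a ∧ Q a then 1 else 0) - c * (if P a then 1 else 0) - c * (if Q a then 1 else 0)
        + c ^ 2 := fun a => by
    by_cases hp : P a <;> by_cases hq : Q a <;> simp only [hp, hq, and_self, and_true, and_false, if_true, if_false] <;> ring
  rw [probOf_eq_mean, mean, div_eq_iff hcard] at hP hQ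
  rw [probOf_eq_mean, mean, mean]
  simp only [hexpand, sum_add_distrib, sum_sub_distrib, ← mul_sum, hP, hQ, sum_const, card_univ,
    nsmul_eq_mul]
  rw [div_eq_iff hcard, sub_mul, div_mul_cancel₀ _ hcard]
  ring

lemma card_sphere (n t : ℕ) : (sphere n t).card = n.choose t := by
  rw [← card_fin n, ← card_powersetCard, card_fin]
  refine card_bij (fun w _ => univ.filter fun i => w i ≠ 0) ?_ ?_ ?_
  · intro w hw
    simpa [sphere, wt, mem_powersetCard] using hw
  · intro v _ w _ h
    funext i
    have hi : v i ≠ 0 ↔ w i ≠ 0 := by simpa using Finset.ext_iff.mp h i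
    generalize v i = a at hi
    generalize w i = b at hi
    revert a b
    decide
  · intro s hs
    refine ⟨fun i => if i ∈ s then 1 else 0, ?_, ?_⟩
    · simpa [sphere, wt, mem_powersetCard] using hs
    · ext i
      simp

lemma sphere_ne_zero {n t : ℕ} (ht : 1 ≤ t) {w : Fin n → ZMod 2} (hw : w ∈ sphere n t) :
    w ≠ 0 := by
  rintro rfl
  simp [sphere, wt] at hw
  omega

lemma numChecks_sub_eq_sum {n d : ℕ} (t : ℕ) (G : Matrix (Fin n) (Fin d) (ZMod 2)) (c : ℝ) :
    (numChecks t G : ℝ) - n.choose t * c =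
      ∑ w ∈ sphere n t, ((if Matrix.vecMul w G = 0 then 1 else 0) - c) := by
  rw [sum_sub_distrib, sum_const, card_sphere, nsmul_eq_mul, sum_boole, sphere, filter_filter]
  rfl

lemma mean_numChecks_sub_sq {n d t : ℕ} (ht : 1 ≤ t) :
    mean (fun G : Matrix (Fin n) (Fin d) (ZMod 2) =>
      ((numChecks t G : ℝ) - n.choose t * (2 : ℝ) ^ (-(d : ℤ))) ^ 2) =
      n.choose t * ((2 : ℝ) ^ (-(d : ℤ)) - ((2 : ℝ) ^ (-(d : ℤ))) ^ 2) := by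
  simp only [numChecks_sub_eq_sum, sq (∑ w ∈ _, _), sum_mul_sum, mean_sum]
  rw [← card_sphere, ← nsmul_eq_mul, ← sum_const]
  refine sum_congr rfl fun v hv => ?_
  have hv0 := sphere_ne_zero ht hv
  rw [sum_eq_single_of_mem v hv]
  · rw [mean_centered_mul _ _ (probOf_vecMul_eq_zero hv0) (probOf_vecMul_eq_zero hv0)]
    simp only [and_self, probOf_vecMul_eq_zero hv0]
  · intro w hw hwv
    have hw0 := sphere_ne_zero ht hw
    rw [mean_centered_mul _ _ (probOf_vecMul_eq_zero hv0) (probOf_vecMul_eq_zero hw0),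
      probOf_vecMul_eq_zero_and hv0 hw0 hwv.symm, sub_self]

/-- For `1 ≤ t ≤ n`, uniformly random `G ∈ F_2^{n×d}`, and any `τ > 0`,
`Pr[ |N_{Im(G),t} - binom(n,t)·2^{-d}| > τ ] ≤ binom(n,t)·(2^{-d} - 2^{-2d}) / τ²`. -/
theorem numChecks_chebyshev {n d : ℕ} (t : ℕ) (ht1 : 1 ≤ t) (ht2 : t ≤ n)
    (τ : ℝ) (hτ : 0 < τ) :
    probOf (fun G : Matrix (Fin n) (Fin d) (ZMod 2) =>
        τ < |(numChecks t G : ℝ) - (n.choose t : ℝ) * (2 : ℝ) ^ (-(d : ℤ))|) ≤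
      (n.choose t : ℝ) * ((2 : ℝ) ^ (-(d : ℤ)) - (2 : ℝ) ^ (-(2 * d : ℤ))) / τ ^ 2 := by
  refine (probOf_abs_gt_le _ hτ).trans_eq ?_
  rw [mean_numChecks_sub_sq ht1, ← zpow_natCast, ← zpow_mul]
  congr 4
  push_cast
  ring
end
end

section
/- Let x ∈ F_2^n and let t be an even integer with 2 ≤ t ≤ √(n/2). Then bias(S_{t,n}, x) ≥ -(2t²/n)^{t/2}. -/
open Finset
open scoped Classical

noncomputable section

open Polynomial in
/-- The generating polynomial `∏ (1 + u i X)` of a sign vector satisfies a first-order linear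
differential equation. -/
theorem one_sub_sq_mul_derivative_prod {ι : Type*} (A : Finset ι) (u : ι → ℝ)
    (hu : ∀ i, u i ^ 2 = 1) :
    (1 - X ^ 2) * derivative (∏ i ∈ A, (1 + C (u i) * X)) =
      (C (∑ i ∈ A, u i) - C (A.card : ℝ) * X) * ∏ i ∈ A, (1 + C (u i) * X) := by
  induction A using Finset.induction_on with
  | empty => simp
  | insert a A ha ih =>
    rw [Finset.prod_insert ha, Finset.sum_insert ha, Finset.card_insert_of_notMem ha,
      derivative_mul]
    have h : (C (u a) : ℝ[X]) ^ 2 = 1 := by rw [← C_pow, hu, C_1]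
    simp only [derivative_add, derivative_one, derivative_C_mul, derivative_X, C_add,
      Nat.cast_add, Nat.cast_one, C_1]
    linear_combination (1 + C (u a) * X) * ih -
      X * (∏ i ∈ A, (1 + C (u i) * X)) * h

open Polynomial in
theorem coeff_prod_one_add_C_mul_X {ι : Type*} (A : Finset ι) (u : ι → ℝ) (j : ℕ) :
    (∏ i ∈ A, (1 + C (u i) * X)).coeff j = ∑ B ∈ A.powersetCard j, ∏ i ∈ B, u i := by
  rw [Finset.prod_one_add, finsetSum_coeff, Finset.powersetCard_eq_filter,
    Finset.sum_filter]
  refine Finset.sum_congr rfl fun B _ => ?_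
  rw [Finset.prod_mul_distrib, Finset.prod_const, ← map_prod, coeff_C_mul_X_pow]
  simp only [eq_comm]

theorem esymm_sign_one {n : ℕ} (u : Fin n → ℝ) :
    ∑ B ∈ (univ : Finset (Fin n)).powersetCard 1, ∏ i ∈ B, u i = ∑ i, u i := by
  simp [Finset.powersetCard_one]

open Polynomial in
theorem esymm_sign_recurrence {n : ℕ} (u : Fin n → ℝ) (hu : ∀ i, u i ^ 2 = 1) (j : ℕ) :
    ((j : ℝ) + 2) * ∑ B ∈ (univ : Finset (Fin n)).powersetCard (j + 2), ∏ i ∈ B, u i =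
      (∑ i, u i) * ∑ B ∈ (univ : Finset (Fin n)).powersetCard (j + 1), ∏ i ∈ B, u i -
      ((n : ℝ) - j) * ∑ B ∈ (univ : Finset (Fin n)).powersetCard j, ∏ i ∈ B, u i := by
  have h := congrArg (fun p => coeff p (j + 1)) (one_sub_sq_mul_derivative_prod univ u hu)
  simp only [sub_mul, one_mul, mul_assoc, coeff_sub, coeff_C_mul, coeff_X_mul,
    coeff_derivative, Finset.card_univ, Fintype.card_fin] at h
  have h2 : (X ^ 2 * derivative (∏ i, (1 + C (u i) * X))).coeff (j + 1) =
      (∏ i, (1 + C (u i) * X)).coeff j * (j : ℝ) := by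
    rw [coeff_X_pow_mul']
    cases j with
    | zero => simp
    | succ k => simp [coeff_derivative]
  rw [h2] at h
  simp only [coeff_prod_one_add_C_mul_X] at h
  push_cast at h
  linear_combination h

theorem chi_add (a b : ZMod 2) : chi (a + b) = chi a * chi b := by
  rw [chi, ZMod.val_add, ← neg_one_pow_eq_pow_mod_two, pow_add]
  rfl

theorem chi_sum {ι : Type*} (A : Finset ι) (f : ι → ZMod 2) :
    chi (∑ i ∈ A, f i) = ∏ i ∈ A, chi (f i) := by
  induction A using Finset.induction_on with
  | empty => simp [chi]
  | insert a A ha ih => rw [Finset.sum_insert ha, Finset.prod_insert ha, chi_add, ih]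

theorem chi_sq (a : ZMod 2) : chi a ^ 2 = 1 := by
  rw [chi, ← pow_mul, mul_comm, pow_mul]
  simp

theorem chi_ip {n : ℕ} (w x : Fin n → ZMod 2) :
    chi (ip w x) = ∏ i with w i ≠ 0, chi (x i) := by
  rw [ip, chi_sum, Finset.prod_filter]
  refine Finset.prod_congr rfl fun i _ => ?_
  split_ifs with h
  · rw [show w i = 1 from Fin.eq_one_of_ne_zero _ h, one_mul]
  · simp [not_not.mp h, chi]

/-- Sums over the sphere of functions of the support are sums over `t`-subsets. -/
theorem sum_sphere {n : ℕ} (t : ℕ) (f : Finset (Fin n) → ℝ) :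
    ∑ w ∈ sphere n t, f {i | w i ≠ 0} = ∑ B ∈ (univ : Finset (Fin n)).powersetCard t, f B := by
  refine Finset.sum_bij' (fun w _ => ({i | w i ≠ 0} : Finset (Fin n)))
    (fun B _ i => if i ∈ B then 1 else 0) ?_ ?_ ?_ ?_ ?_
  · intro w hw
    simpa [sphere, wt, Finset.mem_powersetCard] using hw
  · intro B hB
    simpa [sphere, wt, Finset.mem_powersetCard] using hB
  · intro w _
    funext i
    by_cases h : w i = 0
    · simp [h]
    · simp [show w i = 1 from Fin.eq_one_of_ne_zero _ h]
  · intro B _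
    ext i
    simp
  · intros
    rfl

theorem biasS_sphere {n : ℕ} (t : ℕ) (x : Fin n → ZMod 2) :
    biasS (sphere n t) x =
      (∑ B ∈ (univ : Finset (Fin n)).powersetCard t, ∏ i ∈ B, chi (x i)) / n.choose t := by
  have hc : ((sphere n t).card : ℝ) = n.choose t := by
    have h := sum_sphere (n := n) t fun _ => 1
    simpa using h
  rw [biasS, hc, ← sum_sphere]
  simp only [chi_ip]

theorem biasS_sphere_recurrence {n : ℕ} (x : Fin n → ZMod 2) (j : ℕ) (hj : j + 2 ≤ n) :
    ((n : ℝ) - (j + 1)) * biasS (sphere n (j + 2)) x =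
      (∑ i, chi (x i)) * biasS (sphere n (j + 1)) x - (j + 1) * biasS (sphere n j) x := by
  have h := esymm_sign_recurrence (fun i => chi (x i)) (fun i => chi_sq _) j
  simp only [biasS_sphere]
  have c0 : (n.choose j : ℝ) ≠ 0 := by exact_mod_cast (Nat.choose_pos (by omega)).ne'
  have hjn : (j : ℝ) + 2 ≤ n := by exact_mod_cast hj
  have r0 : (n.choose (j + 1) : ℝ) * (j + 1) = n.choose j * (n - j) := by
    have := Nat.choose_succ_right_eq n j
    rw [← Nat.cast_sub (by omega)]
    exact_mod_cast this
  have r1 : (n.choose (j + 2) : ℝ) * (j + 2) = n.choose (j + 1) * (n - (j + 1)) := by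
    have := Nat.choose_succ_right_eq n (j + 1)
    rw [← Nat.cast_add_one, ← Nat.cast_sub (by omega)]
    exact_mod_cast this
  have d1 : (n.choose (j + 1) : ℝ) = n.choose j * (n - j) / (j + 1) := by
    rw [eq_div_iff (by positivity), r0]
  have d2 : (n.choose (j + 2) : ℝ) = n.choose (j + 1) * (n - (j + 1)) / (j + 2) := by
    rw [eq_div_iff (by positivity), r1]
  have e1 : (n : ℝ) - j ≠ 0 := by linarith
  have e2 : (n : ℝ) - (j + 1) ≠ 0 := by linarith
  have e3 : (j : ℝ) + 1 ≠ 0 := by positivity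
  have e4 : (j : ℝ) + 2 ≠ 0 := by positivity
  rw [d2, d1]
  generalize (∑ B ∈ (univ : Finset (Fin n)).powersetCard (j + 2), ∏ i ∈ B, chi (x i)) = E2 at *
  generalize (∑ B ∈ (univ : Finset (Fin n)).powersetCard (j + 1), ∏ i ∈ B, chi (x i)) = E1 at *
  generalize (∑ B ∈ (univ : Finset (Fin n)).powersetCard j, ∏ i ∈ B, chi (x i)) = E0 at *
  field_simp
  linear_combination h

theorem nonneg_of_recurrence {n s : ℝ} {t : ℕ} {b : ℕ → ℝ} (hs : 0 < s) (htn : t < n)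
    (hst : 4 * n * (t - 1) ≤ s ^ 2) (h0 : b 0 = 1) (h1 : n * b 1 = s)
    (hrec : ∀ j : ℕ, j + 2 ≤ t → (n - (j + 1)) * b (j + 2) = s * b (j + 1) - (j + 1) * b j) :
    0 ≤ b t := by
  have hn : 0 < n := lt_of_le_of_lt (Nat.cast_nonneg t) htn
  have key : ∀ j : ℕ, j + 1 ≤ t → 0 ≤ b j ∧ 0 ≤ b (j + 1) ∧ s * b j ≤ 2 * n * b (j + 1) := by
    intro j
    induction j with
    | zero =>
      intro _
      refine ⟨by simp [h0], ?_, ?_⟩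
      · exact le_of_lt (pos_of_mul_pos_right (h1 ▸ hs) hn.le)
      · rw [h0, zero_add]
        linarith
    | succ j ih =>
      intro hj
      obtain ⟨p0, p1, hr⟩ := ih (by omega)
      have hjt : (j : ℝ) + 2 ≤ t := by exact_mod_cast hj
      have r := hrec j hj
      have hsj : 4 * n * (j + 1) ≤ s ^ 2 := by nlinarith
      have hhalf : (j + 1) * b j ≤ s / 2 * b (j + 1) := by
        have i1 : (j + 1) * (s * b j) ≤ (j + 1) * (2 * n * b (j + 1)) := by gcongr
        have i2 : 4 * n * (j + 1) * b (j + 1) ≤ s ^ 2 * b (j + 1) := by gcongr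
        refine le_of_mul_le_mul_left ?_ hs
        linarith
      have hpos : 0 ≤ b (j + 2) := by
        have : 0 ≤ (n - (j + 1)) * b (j + 2) := by
          rw [r]
          have : 0 ≤ s / 2 * b (j + 1) := by positivity
          linarith
        exact nonneg_of_mul_nonneg_right this (by linarith)
      refine ⟨p1, hpos, ?_⟩
      have : 0 ≤ ((j : ℝ) + 1) * b (j + 2) := by positivity
      show s * b (j + 1) ≤ 2 * n * b (j + 2)
      linarith
  rcases t with _ | t
  · simp [h0]
  · exact (key t le_rfl).2.1

theorem abs_le_pow_of_recurrence {n s l : ℝ} {t : ℕ} {b : ℕ → ℝ} (hl : 0 ≤ l) (htn : t < n)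
    (h0 : b 0 = 1) (h1 : |b 1| ≤ l)
    (hstep : |s| * l + (t - 1) ≤ (n - (t - 1)) * l ^ 2)
    (hrec : ∀ j : ℕ, j + 2 ≤ t → (n - (j + 1)) * b (j + 2) = s * b (j + 1) - (j + 1) * b j) :
    ∀ j ≤ t, |b j| ≤ l ^ j := by
  intro j
  induction j using Nat.twoStepInduction with
  | zero => simp [h0]
  | one => simpa using fun _ => h1
  | more j ih0 ih1 =>
    intro hj
    have hjt : (j : ℝ) + 2 ≤ t := by exact_mod_cast hj
    have b0 := ih0 (by omega)
    have b1 := ih1 (by omega)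
    have hp : 0 < n - (j + 1) := by linarith
    have hj1 : (0 : ℝ) ≤ j + 1 := by positivity
    refine le_of_mul_le_mul_left ?_ hp
    calc (n - (j + 1)) * |b (j + 2)| = |s * b (j + 1) - (j + 1) * b j| := by
          rw [← hrec j hj, abs_mul, abs_of_pos hp]
      _ ≤ |s| * |b (j + 1)| + (j + 1) * |b j| := by
          refine (abs_sub _ _).trans_eq ?_
          rw [abs_mul, abs_mul, abs_of_nonneg hj1]
      _ ≤ |s| * l ^ (j + 1) + (j + 1) * l ^ j := by gcongr
      _ = (|s| * l + (j + 1)) * l ^ j := by ring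
      _ ≤ ((n - (j + 1)) * l ^ 2) * l ^ j := by
          gcongr
          nlinarith [mul_nonneg (sub_nonneg.mpr hjt) (sq_nonneg l)]
      _ = (n - (j + 1)) * l ^ (j + 2) := by ring

/-- For `x ∈ F_2^n` and even `t` with `2 ≤ t ≤ √(n/2)`,
`bias(S_{t,n}, x) ≥ -(2t²/n)^{t/2}`. -/
theorem bias_sphere_lower_bound {n : ℕ} (x : Fin n → ZMod 2) (t : ℕ) (htEven : Even t)
    (ht2 : 2 ≤ t) (htn : (t : ℝ) ≤ Real.sqrt ((n : ℝ) / 2)) :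
    -((2 * (t : ℝ) ^ 2 / n) ^ (t / 2)) ≤ biasS (sphere n t) x := by
  have ht : (2 : ℝ) ≤ t := by exact_mod_cast ht2
  have hn : 2 * (t : ℝ) ^ 2 ≤ n := by
    have := (Real.le_sqrt (by positivity) (by positivity)).mp htn
    linarith
  have htn' : (t : ℝ) < n := by nlinarith
  have hnpos : (0 : ℝ) < n := by linarith
  have htn'' : t < n := by exact_mod_cast htn'
  set s : ℝ := ∑ i, chi (x i) with hs
  set b : ℕ → ℝ := fun j => biasS (sphere n j) x with hb
  have h0 : b 0 = 1 := by simp [hb, biasS_sphere]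
  have h1 : n * b 1 = s := by
    simp only [hb, biasS_sphere, esymm_sign_one, Nat.choose_one_right]
    exact mul_div_cancel₀ _ hnpos.ne'
  have hrec : ∀ j : ℕ, j + 2 ≤ t →
      ((n : ℝ) - (j + 1)) * b (j + 2) = s * b (j + 1) - (j + 1) * b j :=
    fun j hj => biasS_sphere_recurrence x j (by omega)
  change _ ≤ b t
  by_cases hst : 4 * (n : ℝ) * (t - 1) ≤ s ^ 2
  · refine le_trans (neg_nonpos.mpr (by positivity)) ?_
    have hs0 : s ≠ 0 := by
      intro h
      rw [h] at hst
      nlinarith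
    rcases hs0.lt_or_gt with hneg | hpos
    · have := nonneg_of_recurrence (b := fun j => (-1) ^ j * b j) (neg_pos.mpr hneg) htn'
        (by rwa [neg_sq]) (by simp [h0]) (by rw [← h1]; ring) (by
          intro j hj
          linear_combination (-1) ^ j * hrec j hj)
      simpa [htEven.neg_one_pow] using this
    · exact nonneg_of_recurrence hpos htn' hst h0 h1 hrec
  · set l : ℝ := √(2 * (t : ℝ) ^ 2 / n) with hl
    have hl0 : 0 ≤ l := Real.sqrt_nonneg _
    have hl2 : l ^ 2 = 2 * (t : ℝ) ^ 2 / n := Real.sq_sqrt (by positivity)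
    have hnl : n * l ^ 2 = 2 * (t : ℝ) ^ 2 := by
      rw [hl2]
      field_simp
    have hl1 : l ^ 2 ≤ 1 := by
      rw [hl2]
      exact div_le_one_of_le₀ hn hnpos.le
    push Not at hst
    have hsl : |s| * l ≤ t * (t + 1) := by
      refine abs_le_of_sq_le_sq' ?_ (by positivity) |>.2
      rw [mul_pow, sq_abs]
      have : s ^ 2 * l ^ 2 ≤ 4 * n * (t - 1) * l ^ 2 := by gcongr
      nlinarith [sq_nonneg ((t : ℝ) * (t - 3))]
    have hb1 : |b 1| ≤ l := by
      refine abs_le_of_sq_le_sq ?_ hl0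
      have : (n * b 1) ^ 2 ≤ n * (n * l ^ 2) := by
        rw [h1, hnl]
        nlinarith [mul_nonneg hnpos.le (sq_nonneg ((t : ℝ) - 1))]
      refine le_of_mul_le_mul_left ?_ (pow_pos hnpos 2)
      linarith
    have hbt := abs_le_pow_of_recurrence hl0 htn' h0 hb1 (by nlinarith) hrec t le_rfl
    have hpow : l ^ t = (2 * (t : ℝ) ^ 2 / n) ^ (t / 2) := by
      rw [← hl2, ← pow_mul, Nat.mul_div_cancel' htEven.two_dvd]
    rw [← hpow]
    exact (abs_le.mp hbt).1
end
end
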